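/- For every positive integer n and every T ⊆ [n], the polynomial A^{T-1}_n(x) is real-rooted and it interlaces A^T_{n+1}(x), where T-1 = {a-1 : a ∈ T}. -/

import Mathlib

open Polynomial

open scoped Classical

noncomputable section

/-- The descent set of a permutation `w` of `Fin n`, recorded as a subset of
`{1, ..., n-1}` (1-based positions, as in the paper: `i ∈ Des(w)` iff `w(i) > w(i+1)`). -/
def descSet {n : ℕ} (w : Equiv.Perm (Fin n)) : Finset ℕ :=
  (Finset.univ.filter (fun i : Fin (n - 1) =>
      w ⟨i.val + 1, by have := i.isLt; omega⟩ < w ⟨i.val, by have := i.isLt; omega⟩)).image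
    (fun i => i.val + 1)

/-- `A^T_n(x) = Σ_{w ∈ S_n, Des(w) ⊆ T} x^{des(w)}` (note `Des(w) ⊆ {1,...,n-1}`
automatically, so this also realizes the convention `A^T_n := A^{T ∩ [n-1]}_n`). -/
def Apoly (n : ℕ) (T : Finset ℕ) : Polynomial ℝ :=
  ∑ w ∈ Finset.univ.filter (fun w : Equiv.Perm (Fin n) => descSet w ⊆ T),
    X ^ (descSet w).card

/-- `p^T_{n,k}(x) = Σ x^{des(w)}` over permutations `w ∈ S_{n+1}` with `w(1) = k+1`
(0-based: `w 0 = k`) and `Des(w) ⊆ T`. -/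
def ppoly (n k : ℕ) (T : Finset ℕ) : Polynomial ℝ :=
  ∑ w ∈ Finset.univ.filter (fun w : Equiv.Perm (Fin (n + 1)) =>
      (w 0 : ℕ) = k ∧ descSet w ⊆ T),
    X ^ (descSet w).card

/-- A real polynomial has only real roots (or is identically zero). -/
def RealRooted (p : Polynomial ℝ) : Prop :=
  p = 0 ∨ ∀ z : ℂ, Polynomial.aeval z p = 0 → z.im = 0

/-- The list of real roots of `p`, with multiplicity, in decreasing order. -/
def rootsDesc (p : Polynomial ℝ) : List ℝ :=
  (p.roots.sort (· ≤ ·)).reverse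

/-- `Interlaces p q` means `p ⪯ q`: both are real-rooted and, listing the roots of `p`
as `α_1 ≥ α_2 ≥ ⋯` and those of `q` as `β_1 ≥ β_2 ≥ ⋯`, one has
`⋯ ≤ α_2 ≤ β_2 ≤ α_1 ≤ β_1`; by convention the zero polynomial interlaces and is
interlaced by every real-rooted polynomial. -/
def Interlaces (p q : Polynomial ℝ) : Prop :=
  (p = 0 ∧ RealRooted q) ∨ (q = 0 ∧ RealRooted p) ∨
  (RealRooted p ∧ RealRooted q ∧
    Multiset.card q.roots ≤ Multiset.card p.roots + 1 ∧
    Multiset.card p.roots ≤ Multiset.card q.roots ∧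
    (∀ (i : ℕ) (hp : i < (rootsDesc p).length) (hq : i < (rootsDesc q).length),
      (rootsDesc p).get ⟨i, hp⟩ ≤ (rootsDesc q).get ⟨i, hq⟩) ∧
    (∀ (i : ℕ) (hq : i + 1 < (rootsDesc q).length) (hp : i < (rootsDesc p).length),
      (rootsDesc q).get ⟨i + 1, hq⟩ ≤ (rootsDesc p).get ⟨i, hp⟩))

/-- Value-level interlacing condition at a point `z` of the upper half plane. -/
def VV (z a b : ℂ) : Prop :=
  0 ≤ b.im * a.re - b.re * a.im ∧
  0 ≤ (z * a).im * b.re - (z * a).re * b.im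

lemma VV_self (z a : ℂ) (hz : 0 < z.im) : VV z a a := by
  refine ⟨by linarith [mul_comm a.im a.re], ?_⟩
  have : (z * a).im * a.re - (z * a).re * a.im = z.im * (a.re ^ 2 + a.im ^ 2) := by
    simp only [Complex.mul_re, Complex.mul_im]; ring
  rw [this]; positivity

lemma VV_zero_left (z b : ℂ) : VV z 0 b := by simp [VV]

lemma VV_zero_right (z b : ℂ) : VV z b 0 := by simp [VV]

lemma VV_add_left {z a a' b : ℂ} (h : VV z a b) (h' : VV z a' b) : VV z (a + a') b := by
  obtain ⟨h1, h2⟩ := h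
  obtain ⟨h3, h4⟩ := h'
  refine ⟨?_, ?_⟩
  · simp only [Complex.add_re, Complex.add_im]; linarith
  · rw [mul_add]; simp only [Complex.add_re, Complex.add_im]; linarith

lemma VV_add_right {z a b b' : ℂ} (h : VV z a b) (h' : VV z a b') : VV z a (b + b') := by
  obtain ⟨h1, h2⟩ := h
  obtain ⟨h3, h4⟩ := h'
  refine ⟨?_, ?_⟩
  · simp only [Complex.add_re, Complex.add_im]; linarith
  · simp only [Complex.add_re, Complex.add_im]; linarith

lemma VV_sum_left {ι : Type*} {z b : ℂ} (s : Finset ι) (v : ι → ℂ)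
    (h : ∀ i ∈ s, VV z (v i) b) : VV z (∑ i ∈ s, v i) b :=
  Finset.sum_induction v (fun a => VV z a b) (fun _ _ => VV_add_left) (VV_zero_left z b) h

lemma VV_sum_right {ι : Type*} {z a : ℂ} (s : Finset ι) (v : ι → ℂ)
    (h : ∀ i ∈ s, VV z a (v i)) : VV z a (∑ i ∈ s, v i) :=
  Finset.sum_induction v (fun b => VV z a b) (fun _ _ => VV_add_right) (VV_zero_right z a) h

lemma VV_sum_sum {ι : Type*} {z : ℂ} (s t : Finset ι) (v : ι → ℂ)
    (h : ∀ i ∈ s, ∀ j ∈ t, VV z (v i) (v j)) : VV z (∑ i ∈ s, v i) (∑ i ∈ t, v i) :=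
  VV_sum_left s v fun i hi => VV_sum_right t v fun j hj => h i hi j hj

/-- nonzero-ness of sums -/
lemma VV_add_eq_zero {z a b : ℂ} (hz : 0 < z.im) (h : VV z a b) (h0 : a + b = 0) :
    a = 0 ∧ b = 0 := by
  have hb : b = -a := by linear_combination h0
  subst hb
  obtain ⟨-, h2⟩ := h
  have e : (z * a).im * (-a).re - (z * a).re * (-a).im = -(z.im * (a.re ^ 2 + a.im ^ 2)) := by
    simp only [Complex.mul_re, Complex.mul_im, Complex.neg_re, Complex.neg_im]; ring
  rw [e] at h2
  have h3 : a.re ^ 2 + a.im ^ 2 ≤ 0 := by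
    by_contra hc
    push Not at hc
    have := mul_pos hz hc
    linarith
  have h4 : a = 0 := by
    apply Complex.ext
    · simp; nlinarith [sq_nonneg a.re, sq_nonneg a.im]
    · simp; nlinarith [sq_nonneg a.re, sq_nonneg a.im]
  simp [h4]

lemma VV_mul_add_eq_zero {z a b : ℂ} (hz : 0 < z.im) (h : VV z a b) (h0 : z * a + b = 0) :
    a = 0 ∧ b = 0 := by
  have hb : b = -(z * a) := by linear_combination h0
  subst hb
  obtain ⟨h2, -⟩ := h
  have e : (-(z * a)).im * a.re - (-(z * a)).re * a.im = -(z.im * (a.re ^ 2 + a.im ^ 2)) := by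
    simp only [Complex.mul_re, Complex.mul_im, Complex.neg_re, Complex.neg_im]; ring
  rw [e] at h2
  have h3 : a.re ^ 2 + a.im ^ 2 ≤ 0 := by
    by_contra hc
    push Not at hc
    have := mul_pos hz hc
    linarith
  have h4 : a = 0 := by
    apply Complex.ext
    · simp; nlinarith [sq_nonneg a.re, sq_nonneg a.im]
    · simp; nlinarith [sq_nonneg a.re, sq_nonneg a.im]
  simp [h4]

lemma VV_sum_eq_zero {m : ℕ} {z : ℂ} (hz : 0 < z.im) (v : Fin m → ℂ)
    (hv : ∀ i j, i ≤ j → VV z (v i) (v j)) (s : Finset (Fin m)) :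
    ∑ i ∈ s, v i = 0 → ∀ i ∈ s, v i = 0 := by
  induction s using Finset.induction_on_max with
  | empty => simp
  | insert a s hs ih =>
    intro h
    have ha : a ∉ s := fun h => lt_irrefl _ (hs a h)
    rw [Finset.sum_insert ha, add_comm] at h
    have := VV_add_eq_zero hz (VV_sum_left s v fun i hi => hv i a (hs i hi).le) h
    intro i hi
    rcases Finset.mem_insert.1 hi with rfl | hi
    · exact this.2
    · exact ih this.1 i hi

/-- The key closure property. -/
lemma VV_step {z a b c : ℂ} (hz : 0 < z.im) (hab : VV z a b) (hac : VV z a c) (hbc : VV z b c) :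
    VV z (z * a + b + c) (z * a + z * b + c) := by
  have hbb := (VV_self z b hz).2
  obtain ⟨x, y⟩ := z
  obtain ⟨a1, a2⟩ := a
  obtain ⟨b1, b2⟩ := b
  obtain ⟨c1, c2⟩ := c
  simp only [VV, Complex.mul_re, Complex.mul_im, Complex.add_re, Complex.add_im] at *
  obtain ⟨hab1, hab2⟩ := hab
  obtain ⟨hac1, hac2⟩ := hac
  obtain ⟨hbc1, hbc2⟩ := hbc
  have hn : 0 ≤ x ^ 2 + y ^ 2 := by positivity
  constructor
  · have := mul_nonneg hn hab1
    linarith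
  · have h1 := mul_nonneg hn hab1
    have h2 := mul_nonneg hn hab2
    have h3 := mul_nonneg hn hbc1
    have h4 : 0 ≤ y * ((x * a1 - y * a2 + c1) ^ 2 + (x * a2 + y * a1 + c2) ^ 2) := by
      positivity
    linarith

/-- The invariant of the family. -/
def Good {m : ℕ} (p : Fin m → ℝ[X]) : Prop :=
  ∀ z : ℂ, 0 < z.im → (∀ i j, i ≤ j → VV z (aeval z (p i)) (aeval z (p j))) ∧
    ∀ i, aeval z (p i) = 0 → p i = 0

lemma sum_split {m : ℕ} {M : Type*} [CommSemiring M] (v : Fin m → M) (k : ℕ) (y : M) :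
    ∑ j : Fin m, (if (j : ℕ) < k then y else 1) * v j =
      y * ∑ j ∈ Finset.univ.filter (fun j : Fin m => (j : ℕ) < k), v j +
        ∑ j ∈ Finset.univ.filter (fun j : Fin m => k ≤ (j : ℕ)), v j := by
  rw [Finset.mul_sum, Finset.sum_filter, Finset.sum_filter, ← Finset.sum_add_distrib]
  refine Finset.sum_congr rfl fun j _ => ?_
  by_cases h : (j : ℕ) < k
  · simp [h, not_le.2 h]
  · simp [h, not_lt.1 h]

lemma Good_step {m : ℕ} (p : Fin m → ℝ[X]) (hp : Good p) {m' : ℕ} (q : Fin m' → ℝ[X]) (b : Prop)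
    (hq : ∀ k, q k = ∑ j : Fin m, (if (j : ℕ) < (k : ℕ) then (if b then X else 0) else 1) * p j) :
    Good q := by
  intro z hz
  obtain ⟨h1, h2⟩ := hp z hz
  have hev : ∀ k, aeval z (q k) = (if b then z else 0) *
      ∑ j ∈ Finset.univ.filter (fun j : Fin m => (j : ℕ) < k), aeval z (p j) +
        ∑ j ∈ Finset.univ.filter (fun j : Fin m => (k : ℕ) ≤ (j : ℕ)), aeval z (p j) := by
    intro k
    rw [hq, sum_split]
    by_cases hb : b <;> simp [hb]
  have hle : ∀ k l : ℕ, k ≤ l → ∑ j ∈ Finset.univ.filter (fun j : Fin m => k ≤ (j : ℕ)), aeval z (p j)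
      = ∑ j ∈ Finset.univ.filter (fun j : Fin m => k ≤ (j : ℕ) ∧ (j : ℕ) < l), aeval z (p j)
      + ∑ j ∈ Finset.univ.filter (fun j : Fin m => l ≤ (j : ℕ)), aeval z (p j) := by
    intro k l hkl
    rw [← Finset.sum_union]
    · congr 1
      ext j; simp; omega
    · rw [Finset.disjoint_left]; intro j; simp
  have hlt : ∀ k l : ℕ, k ≤ l → ∑ j ∈ Finset.univ.filter (fun j : Fin m => (j : ℕ) < l), aeval z (p j)
      = ∑ j ∈ Finset.univ.filter (fun j : Fin m => (j : ℕ) < k), aeval z (p j)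
      + ∑ j ∈ Finset.univ.filter (fun j : Fin m => k ≤ (j : ℕ) ∧ (j : ℕ) < l), aeval z (p j) := by
    intro k l hkl
    rw [← Finset.sum_union]
    · congr 1
      ext j; simp; omega
    · rw [Finset.disjoint_left]; intro j; simp; omega
  constructor
  · intro k l hkl
    have hkl' : (k : ℕ) ≤ l := hkl
    rw [hev, hev, hle k l hkl', hlt k l hkl']
    have hab := VV_sum_sum (z := z) (Finset.univ.filter (fun j : Fin m => (j : ℕ) < k))
      (Finset.univ.filter (fun j : Fin m => (k : ℕ) ≤ (j : ℕ) ∧ (j : ℕ) < l))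
      (fun j => aeval z (p j)) (by
        intro i hi j hj
        simp at hi hj
        exact h1 i j (by rw [Fin.le_def]; omega))
    have hac := VV_sum_sum (z := z) (Finset.univ.filter (fun j : Fin m => (j : ℕ) < k))
      (Finset.univ.filter (fun j : Fin m => (l : ℕ) ≤ (j : ℕ)))
      (fun j => aeval z (p j)) (by
        intro i hi j hj
        simp at hi hj
        exact h1 i j (by rw [Fin.le_def]; omega))
    have hbc := VV_sum_sum (z := z)
      (Finset.univ.filter (fun j : Fin m => (k : ℕ) ≤ (j : ℕ) ∧ (j : ℕ) < l))
      (Finset.univ.filter (fun j : Fin m => (l : ℕ) ≤ (j : ℕ)))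
      (fun j => aeval z (p j)) (by
        intro i hi j hj
        simp at hi hj
        exact h1 i j (by rw [Fin.le_def]; omega))
    by_cases hb : b
    · simp only [hb, if_true]
      rw [← add_assoc, mul_add]
      exact VV_step hz hab hac hbc
    · simp only [hb, if_false, zero_mul, zero_add]
      exact VV_add_left hbc (VV_self _ _ hz)
  · intro k hk
    rw [hev] at hk
    rw [hq, sum_split]
    have hac := VV_sum_sum (z := z) (Finset.univ.filter (fun j : Fin m => (j : ℕ) < k))
      (Finset.univ.filter (fun j : Fin m => (k : ℕ) ≤ (j : ℕ)))
      (fun j => aeval z (p j)) (by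
        intro i hi j hj
        simp at hi hj
        exact h1 i j (by rw [Fin.le_def]; omega))
    by_cases hb : b
    · simp only [hb, if_true] at hk ⊢
      obtain ⟨e1, e2⟩ := VV_mul_add_eq_zero hz hac hk
      have e1' := VV_sum_eq_zero hz _ h1 _ e1
      have e2' := VV_sum_eq_zero hz _ h1 _ e2
      rw [Finset.sum_eq_zero fun i hi => h2 i (e1' i hi),
        Finset.sum_eq_zero fun i hi => h2 i (e2' i hi)]
      simp
    · simp only [hb, if_false, zero_mul, zero_add] at hk ⊢
      have e2' := VV_sum_eq_zero hz _ h1 _ hk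
      exact Finset.sum_eq_zero fun i hi => h2 i (e2' i hi)

/-! ### Combinatorics -/

/-- Prepend the value `k` to the permutation `σ`. -/
def extPerm {n : ℕ} (k : Fin (n + 2)) (σ : Equiv.Perm (Fin (n + 1))) : Equiv.Perm (Fin (n + 2)) :=
  ((finSuccEquiv' 0).trans (Equiv.optionCongr σ)).trans (finSuccEquiv' k).symm

lemma extPerm_zero {n : ℕ} (k : Fin (n + 2)) (σ : Equiv.Perm (Fin (n + 1))) :
    extPerm k σ 0 = k := by
  simp [extPerm]

lemma extPerm_succ {n : ℕ} (k : Fin (n + 2)) (σ : Equiv.Perm (Fin (n + 1))) (i : Fin (n + 1)) :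
    extPerm k σ i.succ = k.succAbove (σ i) := by
  have : (finSuccEquiv' (0 : Fin (n + 2))) i.succ = some i := by
    rw [← Fin.succAbove_zero_apply, finSuccEquiv'_succAbove]
  simp [extPerm, this]

lemma extPerm_bij (n : ℕ) : Function.Bijective
    (fun x : Fin (n + 2) × Equiv.Perm (Fin (n + 1)) => extPerm x.1 x.2) := by
  rw [Fintype.bijective_iff_injective_and_card]
  constructor
  · rintro ⟨k, σ⟩ ⟨l, τ⟩ h
    simp only at h
    have h0 : k = l := by
      have := congrArg (fun w => w 0) h
      simpa [extPerm_zero] using this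
    subst h0
    congr 1
    ext i
    have := congrArg (fun w => w i.succ) h
    simp only [extPerm_succ] at this
    rw [Fin.succAbove_right_injective this]
  · simp [Fintype.card_perm, Nat.factorial_succ]

lemma mem_descSet {n : ℕ} (w : Equiv.Perm (Fin (n + 1))) (d : ℕ) :
    d ∈ descSet w ↔ ∃ i : Fin n, w i.succ < w i.castSucc ∧ (i : ℕ) + 1 = d := by
  simp only [descSet, Finset.mem_image, Finset.mem_filter, Finset.mem_univ, true_and]
  rfl

lemma descSet_ext {n : ℕ} (k : Fin (n + 2)) (σ : Equiv.Perm (Fin (n + 1))) :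
    descSet (extPerm k σ) =
      (if (σ 0 : ℕ) < k then {1} else ∅) ∪ (descSet σ).image (· + 1) := by
  ext d
  rw [mem_descSet, Finset.mem_union, Finset.mem_image]
  have hz : extPerm k σ (Fin.succ 0) < extPerm k σ (Fin.castSucc 0) ↔ (σ 0 : ℕ) < k := by
    rw [extPerm_succ, Fin.castSucc_zero, extPerm_zero, Fin.succAbove_lt_iff_castSucc_lt]
    rfl
  have hs : ∀ i : Fin n, extPerm k σ i.succ.succ < extPerm k σ i.succ.castSucc ↔
      σ i.succ < σ i.castSucc := by
    intro i
    rw [extPerm_succ, ← Fin.succ_castSucc, extPerm_succ]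
    exact (Fin.strictMono_succAbove k).lt_iff_lt
  constructor
  · rintro ⟨i, hi, rfl⟩
    induction i using Fin.cases with
    | zero => left; rw [if_pos (hz.1 hi)]; simp
    | succ i =>
      right
      exact ⟨i + 1, (mem_descSet _ _).2 ⟨i, (hs i).1 hi, rfl⟩, by simp⟩
  · rintro (h | ⟨e, he, rfl⟩)
    · split_ifs at h with h'
      · simp at h
        exact ⟨0, hz.2 h', by simp [h]⟩
      · simp at h
    · obtain ⟨i, hi, rfl⟩ := (mem_descSet _ _).1 he
      exact ⟨i.succ, (hs i).2 hi, by simp⟩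

lemma descSet_pos {n : ℕ} (w : Equiv.Perm (Fin (n + 1))) (d : ℕ) (h : d ∈ descSet w) : 1 ≤ d := by
  obtain ⟨i, -, rfl⟩ := (mem_descSet _ _).1 h
  omega

lemma descSet_ext_card {n : ℕ} (k : Fin (n + 2)) (σ : Equiv.Perm (Fin (n + 1))) :
    (descSet (extPerm k σ)).card = (if (σ 0 : ℕ) < k then 1 else 0) + (descSet σ).card := by
  rw [descSet_ext, Finset.card_union_of_disjoint, Finset.card_image_of_injective]
  · split_ifs <;> simp
  · exact add_left_injective 1
  · rw [Finset.disjoint_left]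
    intro d hd h
    rw [Finset.mem_image] at h
    obtain ⟨e, he, rfl⟩ := h
    have := descSet_pos _ _ he
    split_ifs at hd
    · simp at hd; omega
    · simp at hd

lemma descSet_ext_subset {n : ℕ} (k : Fin (n + 2)) (σ : Equiv.Perm (Fin (n + 1))) (T : Finset ℕ) :
    descSet (extPerm k σ) ⊆ T ↔ ((σ 0 : ℕ) < k → 1 ∈ T) ∧
      descSet σ ⊆ T.image (fun a => a - 1) := by
  rw [descSet_ext, Finset.union_subset_iff]
  apply and_congr
  · split_ifs with h <;> simp [h]
  · constructor
    · intro h d hd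
      exact Finset.mem_image.2 ⟨d + 1, h (Finset.mem_image_of_mem _ hd), by simp⟩
    · intro h d hd
      obtain ⟨e, he, rfl⟩ := Finset.mem_image.1 hd
      obtain ⟨a, ha, hae⟩ := Finset.mem_image.1 (h he)
      have := descSet_pos _ _ he
      have : a = e + 1 := by omega
      exact this ▸ ha

lemma ppoly_eq (n k : ℕ) (T : Finset ℕ) : ppoly n k T = ∑ w : Equiv.Perm (Fin (n + 1)),
    if (w 0 : ℕ) = k ∧ descSet w ⊆ T then X ^ (descSet w).card else 0 := by
  rw [ppoly, Finset.sum_filter]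

lemma Apoly_eq (n : ℕ) (T : Finset ℕ) : Apoly (n + 1) T = ∑ k : Fin (n + 1), ppoly n k T := by
  simp_rw [ppoly_eq]
  rw [Finset.sum_comm, Apoly, Finset.sum_filter]
  refine Finset.sum_congr rfl fun w _ => ?_
  rw [Finset.sum_eq_single (w 0)]
  · simp
  · intro j _ hj
    rw [if_neg]
    rintro ⟨h, -⟩
    exact hj (Fin.ext h.symm)
  · simp

lemma ppoly_rec (n : ℕ) (k : Fin (n + 2)) (T : Finset ℕ) :
    ppoly (n + 1) k T = ∑ j : Fin (n + 1),
      (if (j : ℕ) < (k : ℕ) then (if 1 ∈ T then X else 0) else 1) *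
        ppoly n j (T.image (fun a => a - 1)) := by
  simp_rw [ppoly_eq, Finset.mul_sum]
  rw [Finset.sum_comm, ← (Equiv.ofBijective _ (extPerm_bij n)).sum_comp, Fintype.sum_prod_type,
    Finset.sum_eq_single k]
  · refine Finset.sum_congr rfl fun σ _ => ?_
    rw [Finset.sum_eq_single (σ 0)]
    · simp only [Equiv.ofBijective_apply, extPerm_zero, descSet_ext_subset, descSet_ext_card,
        true_and]
      by_cases h1 : (σ 0 : ℕ) < k <;> by_cases h2 : 1 ∈ T <;>
        by_cases h3 : descSet σ ⊆ T.image (fun a => a - 1) <;> simp [h1, h2, h3, pow_add]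
    · intro j _ hj
      have hneg : ¬ ((σ 0 : ℕ) = (j : ℕ) ∧ descSet σ ⊆ T.image (fun a => a - 1)) :=
        fun h => hj (Fin.ext h.1.symm)
      rw [if_neg hneg, mul_zero]
    · simp
  · intro l _ hl
    refine Finset.sum_eq_zero fun σ _ => ?_
    rw [if_neg]
    rintro ⟨h, -⟩
    simp only [Equiv.ofBijective_apply, extPerm_zero] at h
    exact hl (Fin.ext h)
  · simp

lemma Good_ppoly (n : ℕ) : ∀ T : Finset ℕ, Good (fun k : Fin (n + 1) => ppoly n k T) := by
  induction n with
  | zero =>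
    intro T z hz
    have h1 : ∀ i : Fin (0 + 1), ppoly 0 (i : ℕ) T = 1 := by
      intro i
      have hd : ∀ w : Equiv.Perm (Fin (0 + 1)), descSet w = ∅ := by
        intro w
        ext d
        rw [mem_descSet]
        simp
      rw [ppoly_eq]
      simp [hd]
    simp only [h1]
    refine ⟨fun i j _ => VV_self _ _ hz, by simp⟩
  | succ n ih =>
    intro T
    exact Good_step (fun k : Fin (n + 1) => ppoly n k (T.image (fun a => a - 1)))
      (ih (T.image (fun a => a - 1))) (fun k : Fin (n + 1 + 1) => ppoly (n + 1) k T) (1 ∈ T)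
      (by intro k; convert ppoly_rec n k T)

lemma Apoly_eq_ppoly (n : ℕ) (T : Finset ℕ) :
    Apoly (n + 1) (T.image (fun a => a - 1)) = ppoly (n + 1) (0 : Fin (n + 2)) T := by
  rw [ppoly_rec, Apoly_eq]
  simp

lemma Apoly_coeff_nonneg (n : ℕ) (T : Finset ℕ) (i : ℕ) : 0 ≤ (Apoly n T).coeff i := by
  rw [Apoly, finsetSum_coeff]
  refine Finset.sum_nonneg fun w _ => ?_
  rw [coeff_X_pow]
  split_ifs <;> simp

/-! ### Analysis -/

lemma realRooted_of_upper (p : ℝ[X]) (h : ∀ z : ℂ, 0 < z.im → aeval z p = 0 → p = 0) :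
    RealRooted p := by
  by_cases hp : p = 0
  · exact Or.inl hp
  right
  intro z hz
  by_contra hne
  rcases lt_or_gt_of_ne hne with h1 | h1
  · refine hp (h (starRingEnd ℂ z) (by simpa using h1) ?_)
    rw [aeval_conj, hz, map_zero]
  · exact hp (h z h1 hz)

/-- Total argument. -/
def theta (s : Multiset ℝ) (z : ℂ) : ℝ := (s.map (fun a : ℝ => Complex.arg (z - (a : ℂ)))).sum

lemma theta_prod (s : Multiset ℝ) (z : ℂ) (hz : 0 < z.im) :
    ∃ r : ℝ, 0 < r ∧ (s.map (fun a : ℝ => z - (a : ℂ))).prod = r * Complex.exp (theta s z * Complex.I) := by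
  induction s using Multiset.induction_on with
  | empty => exact ⟨1, one_pos, by simp [theta]⟩
  | cons a s ih =>
    obtain ⟨r, hr, h⟩ := ih
    have hne : z - (a : ℂ) ≠ 0 := by
      intro h0
      have := congrArg Complex.im h0
      simp at this
      linarith
    refine ⟨‖z - (a : ℂ)‖ * r, by positivity, ?_⟩
    rw [Multiset.map_cons, Multiset.prod_cons, h]
    have : theta (a ::ₘ s) z = Complex.arg (z - a) + theta s z := by simp [theta]
    rw [this]
    push_cast
    rw [add_mul, Complex.exp_add]
    conv_lhs => rw [← Complex.norm_mul_exp_arg_mul_I (z - a)]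
    ring

lemma theta_cont (s : Multiset ℝ) : ContinuousOn (theta s) {z : ℂ | 0 < z.im} := by
  induction s using Multiset.induction_on with
  | empty =>
    have : theta 0 = fun _ => 0 := by ext; simp [theta]
    rw [this]; exact continuousOn_const
  | cons a s ih =>
    have : theta (a ::ₘ s) = fun z => Complex.arg (z - a) + theta s z := by ext; simp [theta]
    rw [this]
    refine ContinuousOn.add ?_ ih
    intro z hz
    apply ContinuousAt.continuousWithinAt
    have : ContinuousAt Complex.arg (z - a) := Complex.continuousAt_arg (by
      right
      simp
      exact (ne_of_gt hz))
    exact ContinuousAt.comp (f := fun z : ℂ => z - a) this (by fun_prop)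

open Filter Topology in
lemma theta_lim (s : Multiset ℝ) (t : ℝ) (ht : t ∉ s) :
    Tendsto (fun e : ℝ => theta s (t + e * Complex.I)) (𝓝[>] 0)
      (𝓝 (Real.pi * (s.filter (fun a => t < a)).card)) := by
  induction s using Multiset.induction_on with
  | empty => simp [theta]
  | cons a s ih =>
    have e1 : ∀ z, theta (a ::ₘ s) z = Complex.arg (z - a) + theta s z := by
      intro z; simp [theta]
    simp only [e1]
    rw [Multiset.mem_cons, not_or] at ht
    have ih := ih ht.2
    have hc : Tendsto (fun e : ℝ => (t : ℂ) + e * Complex.I - a) (𝓝[>] 0) (𝓝 ((t - a : ℝ) : ℂ)) := by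
      have : Continuous (fun e : ℝ => (t : ℂ) + e * Complex.I - a) := by fun_prop
      have h := this.tendsto 0
      simp only [Complex.ofReal_zero, zero_mul, add_zero] at h
      push_cast
      exact h.mono_left nhdsWithin_le_nhds
    rcases lt_or_gt_of_ne ht.1 with h | h
    · rw [Multiset.filter_cons_of_pos _ h, Multiset.card_cons]
      push_cast
      rw [mul_add, mul_one, add_comm (Real.pi * _)]
      refine Tendsto.add ?_ ih
      have hl := Complex.tendsto_arg_nhdsWithin_im_nonneg_of_re_neg_of_im_zero
        (z := ((t - a : ℝ) : ℂ)) (by rw [Complex.ofReal_re]; linarith) (by simp)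
      refine hl.comp (tendsto_nhdsWithin_iff.2 ⟨hc, ?_⟩)
      filter_upwards [self_mem_nhdsWithin] with e he
      have : (0 : ℝ) < e := he
      simp [this.le]
    · rw [Multiset.filter_cons_of_neg _ (not_lt.2 h.le)]
      rw [← zero_add (Real.pi * _)]
      refine Tendsto.add ?_ ih
      have hl : ContinuousAt Complex.arg ((t - a : ℝ) : ℂ) := Complex.continuousAt_arg (by
        left; rw [Complex.ofReal_re]; linarith)
      have := hl.tendsto.comp hc
      rwa [Complex.arg_ofReal_of_nonneg (by linarith)] at this

/-- number of roots above `t` -/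
def cnt (s : Multiset ℝ) (t : ℝ) : ℕ := (s.filter (fun a => t < a)).card

open Filter Topology in
lemma count_interlace (s u : Multiset ℝ)
    (h : ∀ z : ℂ, 0 < z.im → 0 ≤ Real.sin (theta u z - theta s z)) (t : ℝ)
    (hs : t ∉ s) (hu : t ∉ u) : cnt s t ≤ cnt u t ∧ cnt u t ≤ cnt s t + 1 := by
  set D : ℂ → ℝ := fun z => theta u z - theta s z with hD
  have hcont : ContinuousOn D {z : ℂ | 0 < z.im} := (theta_cont u).sub (theta_cont s)
  have hconn : IsPreconnected {z : ℂ | 0 < z.im} := (convex_halfSpace_im_gt 0).isPreconnected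
  have hord := (hconn.image D hcont).ordConnected
  have hlim : ∀ t : ℝ, t ∉ s → t ∉ u → Tendsto (fun e : ℝ => D (t + e * Complex.I)) (𝓝[>] 0)
      (𝓝 (Real.pi * cnt u t - Real.pi * cnt s t)) := fun t h1 h2 =>
    (theta_lim u t h2).sub (theta_lim s t h1)
  have hup : ∀ t : ℝ, ∀ᶠ e : ℝ in 𝓝[>] 0, (t + e * Complex.I) ∈ {z : ℂ | 0 < z.im} := by
    intro t
    filter_upwards [self_mem_nhdsWithin] with e he
    simpa using he
  -- a point with small D
  obtain ⟨B, hB⟩ : ∃ B : ℝ, ∀ a ∈ s + u, a < B := by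
    obtain ⟨B, hB⟩ := (s + u).toFinset.bddAbove
    exact ⟨B + 1, fun a ha => by
      have := hB (Finset.mem_coe.2 (Multiset.mem_toFinset.2 ha)); linarith⟩
  have hBs : ∀ a ∈ s, a < B := fun a ha => hB a (Multiset.mem_add.2 (Or.inl ha))
  have hBu : ∀ a ∈ u, a < B := fun a ha => hB a (Multiset.mem_add.2 (Or.inr ha))
  have hzero : ∃ z : ℂ, 0 < z.im ∧ |D z| < Real.pi := by
    have hl := hlim B (fun h => lt_irrefl _ (hBs _ h)) (fun h => lt_irrefl _ (hBu _ h))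
    have c1 : cnt s B = 0 := by
      rw [cnt, Multiset.card_eq_zero, Multiset.filter_eq_nil]
      exact fun a ha => not_lt.2 (hBs a ha).le
    have c2 : cnt u B = 0 := by
      rw [cnt, Multiset.card_eq_zero, Multiset.filter_eq_nil]
      exact fun a ha => not_lt.2 (hBu a ha).le
    rw [c1, c2] at hl
    simp only [Nat.cast_zero, mul_zero, sub_zero] at hl
    have := hl.abs
    rw [abs_zero] at this
    obtain ⟨e, h1, h2⟩ := ((this.eventually (gt_mem_nhds Real.pi_pos)).and (hup B)).exists
    exact ⟨_, h2, h1⟩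
  obtain ⟨z₀, hz₀, hDz₀⟩ := hzero
  rw [abs_lt] at hDz₀
  have hpi := Real.pi_pos
  have hsin : ∀ v ∈ D '' {z : ℂ | 0 < z.im}, 0 ≤ Real.sin v := by
    rintro _ ⟨z, hz, rfl⟩
    exact h z hz
  have hmem₀ : D z₀ ∈ D '' {z : ℂ | 0 < z.im} := ⟨z₀, hz₀, rfl⟩
  have hD0 : 0 ≤ D z₀ := by
    by_contra hc
    push Not at hc
    have := Real.sin_neg_of_neg_of_neg_pi_lt hc hDz₀.1
    linarith [hsin _ hmem₀]
  have hrange : ∀ z : ℂ, 0 < z.im → 0 ≤ D z ∧ D z ≤ Real.pi := by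
    intro z hz
    have hm : D z ∈ D '' {z : ℂ | 0 < z.im} := ⟨z, hz, rfl⟩
    constructor
    · by_contra hc
      push Not at hc
      have hv : max (D z) (-(Real.pi / 2)) ∈ D '' {z : ℂ | 0 < z.im} :=
        hord.out hm hmem₀ ⟨le_max_left _ _, max_le (by linarith) (by linarith)⟩
      have := Real.sin_neg_of_neg_of_neg_pi_lt (x := max (D z) (-(Real.pi / 2)))
        (max_lt hc (by linarith)) (lt_max_of_lt_right (by linarith))
      linarith [hsin _ hv]
    · by_contra hc
      push Not at hc
      have hv : min (D z) (Real.pi + Real.pi / 2) ∈ D '' {z : ℂ | 0 < z.im} :=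
        hord.out hmem₀ hm ⟨le_min (by linarith) (by linarith), min_le_left _ _⟩
      have h3 : 0 < Real.sin (min (D z) (Real.pi + Real.pi / 2) - Real.pi) := by
        apply Real.sin_pos_of_pos_of_lt_pi
        · have := lt_min hc (show Real.pi < Real.pi + Real.pi / 2 by linarith)
          linarith
        · have := min_le_right (D z) (Real.pi + Real.pi / 2)
          linarith
      rw [Real.sin_sub_pi] at h3
      linarith [hsin _ hv]
  have hl := hlim t hs hu
  have g1 := ge_of_tendsto hl ((hup t).mono fun e he => (hrange _ he).1)
  have g2 := le_of_tendsto hl ((hup t).mono fun e he => (hrange _ he).2)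
  constructor
  · have : (cnt s t : ℝ) ≤ cnt u t := by
      have : Real.pi * cnt s t ≤ Real.pi * cnt u t := by linarith
      exact le_of_mul_le_mul_left this hpi
    exact_mod_cast this
  · have : (cnt u t : ℝ) ≤ cnt s t + 1 := by
      have : Real.pi * cnt u t ≤ Real.pi * (cnt s t + 1) := by linarith
      exact le_of_mul_le_mul_left this hpi
    exact_mod_cast this

/-! ### Lists -/

/-- descending list -/
def descL (s : Multiset ℝ) : List ℝ := (s.sort (· ≤ ·)).reverse

lemma descL_coe (s : Multiset ℝ) : (descL s : Multiset ℝ) = s := by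
  rw [descL, Multiset.coe_reverse, Multiset.sort_eq]

lemma descL_sorted (s : Multiset ℝ) : (descL s).Pairwise (· ≥ ·) := by
  rw [descL, List.pairwise_reverse]
  exact Multiset.pairwise_sort s (· ≤ ·)

lemma cnt_descL (s : Multiset ℝ) (t : ℝ) :
    cnt s t = ((descL s).filter (fun a => decide (t < a))).length := by
  conv_lhs => rw [← descL_coe s]
  rw [cnt, Multiset.filter_coe, Multiset.coe_card]

lemma filter_len_ge (l : List ℝ) (hl : l.Pairwise (· ≥ ·)) (t : ℝ) (i : ℕ) (hi : i < l.length)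
    (h : t < l[i]) : i + 1 ≤ (l.filter (fun a => decide (t < a))).length := by
  induction l generalizing i with
  | nil => simp at hi
  | cons a l ih =>
    rw [List.pairwise_cons] at hl
    have ha : t < a := by
      cases i with
      | zero => simpa using h
      | succ i =>
        have := hl.1 (l[i]'(by simpa using hi)) (List.getElem_mem _)
        simp at h
        linarith
    rw [List.filter_cons_of_pos (by simpa using ha), List.length_cons]
    cases i with
    | zero => omega
    | succ i =>
      have := ih hl.2 i (by simpa using hi) (by simpa using h)
      omega

lemma filter_len_le (l : List ℝ) (hl : l.Pairwise (· ≥ ·)) (t : ℝ) (i : ℕ) (hi : i < l.length)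
    (h : l[i] < t) : (l.filter (fun a => decide (t < a))).length ≤ i := by
  induction l generalizing i with
  | nil => simp at hi
  | cons a l ih =>
    rw [List.pairwise_cons] at hl
    cases i with
    | zero =>
      simp at h
      rw [Nat.le_zero, List.length_eq_zero_iff, List.filter_eq_nil_iff]
      intro b hb
      simp only [List.mem_cons] at hb
      rcases hb with rfl | hb
      · simp [h.le]
      · have := hl.1 b hb
        simp; linarith
    | succ i =>
      have h1 := ih hl.2 i (by simpa using hi) (by simpa using h)
      have h2 : ((a :: l).filter (fun a => decide (t < a))).length ≤
          (l.filter (fun a => decide (t < a))).length + 1 := by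
        rw [List.filter_cons]
        split_ifs <;> simp
      omega

lemma exists_between_not_mem (s : Multiset ℝ) (a b : ℝ) (h : a < b) :
    ∃ t, a < t ∧ t < b ∧ t ∉ s := by
  obtain ⟨t, ht, hn⟩ := (Set.Ioo_infinite h).exists_notMem_finset s.toFinset
  exact ⟨t, ht.1, ht.2, fun hm => hn (Multiset.mem_toFinset.2 hm)⟩

lemma interlace_lists (s u : Multiset ℝ)
    (h : ∀ t, t ∉ s → t ∉ u → cnt s t ≤ cnt u t ∧ cnt u t ≤ cnt s t + 1) :
    u.card ≤ s.card + 1 ∧ s.card ≤ u.card ∧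
    (∀ (i : ℕ) (hp : i < (descL s).length) (hq : i < (descL u).length),
      (descL s).get ⟨i, hp⟩ ≤ (descL u).get ⟨i, hq⟩) ∧
    (∀ (i : ℕ) (hq : i + 1 < (descL u).length) (hp : i < (descL s).length),
      (descL u).get ⟨i + 1, hq⟩ ≤ (descL s).get ⟨i, hp⟩) := by
  have hcard : s.card ≤ u.card ∧ u.card ≤ s.card + 1 := by
    obtain ⟨B, hB⟩ : ∃ B : ℝ, ∀ a ∈ s + u, B < a := by
      obtain ⟨B, hB⟩ := (s + u).toFinset.bddBelow
      exact ⟨B - 1, fun a ha => by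
        have := hB (Finset.mem_coe.2 (Multiset.mem_toFinset.2 ha)); linarith⟩
    have hBs : ∀ a ∈ s, B < a := fun a ha => hB a (Multiset.mem_add.2 (Or.inl ha))
    have hBu : ∀ a ∈ u, B < a := fun a ha => hB a (Multiset.mem_add.2 (Or.inr ha))
    have := h B (fun h => lt_irrefl _ (hBs _ h)) (fun h => lt_irrefl _ (hBu _ h))
    rwa [cnt, cnt, Multiset.filter_eq_self.2 hBs, Multiset.filter_eq_self.2 hBu] at this
  refine ⟨hcard.2, hcard.1, ?_, ?_⟩
  · intro i hp hq
    by_contra hc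
    push Not at hc
    obtain ⟨t, h1, h2, h3⟩ := exists_between_not_mem (s + u) _ _ hc
    rw [Multiset.mem_add, not_or] at h3
    have := (h t h3.1 h3.2).1
    rw [cnt_descL, cnt_descL] at this
    have a1 := filter_len_ge _ (descL_sorted s) t i hp h2
    have a2 := filter_len_le _ (descL_sorted u) t i hq h1
    omega
  · intro i hq hp
    by_contra hc
    push Not at hc
    obtain ⟨t, h1, h2, h3⟩ := exists_between_not_mem (s + u) _ _ hc
    rw [Multiset.mem_add, not_or] at h3
    have := (h t h3.1 h3.2).2
    rw [cnt_descL, cnt_descL] at this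
    have a1 := filter_len_ge _ (descL_sorted u) t (i + 1) hq h2
    have a2 := filter_len_le _ (descL_sorted s) t i hp h1
    omega

lemma splits_of_realRooted (p : ℝ[X]) (hp : p ≠ 0) (h : RealRooted p) : p.Splits := by
  have h' := h.resolve_left hp
  rw [splits_iff_splits]
  right
  intro g hg hgp
  have hdeg : 0 < g.degree := degree_pos_of_irreducible hg
  obtain ⟨z, hz⟩ := Complex.exists_root (f := g.map (algebraMap ℝ ℂ)) (by simpa using hdeg)
  have hz' : aeval z g = 0 := by
    rwa [IsRoot, eval_map_algebraMap] at hz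
  have hzp : aeval z p = 0 := by
    obtain ⟨q, rfl⟩ := hgp
    rw [map_mul, hz', zero_mul]
  have him := h' z hzp
  have hzr : z = ((z.re : ℝ) : ℂ) := by apply Complex.ext <;> simp [him]
  have hroot : g.IsRoot z.re := by
    rw [hzr] at hz'
    have : aeval ((z.re : ℝ) : ℂ) g = ((g.eval z.re : ℝ) : ℂ) := by
      exact aeval_algebraMap_apply_eq_algebraMap_eval (A := ℂ) z.re g
    rw [this] at hz'
    exact_mod_cast hz'
  exact degree_eq_one_of_irreducible_of_root hg hroot

lemma aeval_polar (p : ℝ[X]) (hs : p.Splits) (hl : 0 < p.leadingCoeff) (z : ℂ) (hz : 0 < z.im) :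
    ∃ r : ℝ, 0 < r ∧ aeval z p = r * Complex.exp (theta p.roots z * Complex.I) := by
  obtain ⟨r, hr, h⟩ := theta_prod p.roots z hz
  refine ⟨p.leadingCoeff * r, by positivity, ?_⟩
  have e := hs.eq_prod_roots
  have : aeval z p = p.leadingCoeff * (p.roots.map (fun a : ℝ => z - (a : ℂ))).prod := by
    conv_lhs => rw [e]
    rw [map_mul, aeval_C, map_multiset_prod, Multiset.map_map]
    simp
  rw [this, h]
  push_cast
  ring

lemma interlaces_main (p q : ℝ[X]) (hp : RealRooted p) (hq : RealRooted q)
    (cp : ∀ i, 0 ≤ p.coeff i) (cq : ∀ i, 0 ≤ q.coeff i)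
    (h : ∀ z : ℂ, 0 < z.im → VV z (aeval z p) (aeval z q)) : Interlaces p q := by
  by_cases hp0 : p = 0
  · exact Or.inl ⟨hp0, hq⟩
  by_cases hq0 : q = 0
  · exact Or.inr (Or.inl ⟨hq0, hp⟩)
  refine Or.inr (Or.inr ⟨hp, hq, ?_⟩)
  have lp : 0 < p.leadingCoeff := lt_of_le_of_ne (cp _) (Ne.symm (leadingCoeff_ne_zero.2 hp0))
  have lq : 0 < q.leadingCoeff := lt_of_le_of_ne (cq _) (Ne.symm (leadingCoeff_ne_zero.2 hq0))
  have sp := splits_of_realRooted p hp0 hp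
  have sq := splits_of_realRooted q hq0 hq
  refine interlace_lists p.roots q.roots fun t h1 h2 => count_interlace _ _ ?_ t h1 h2
  intro z hz
  obtain ⟨r, hr, e1⟩ := aeval_polar p sp lp z hz
  obtain ⟨r', hr', e2⟩ := aeval_polar q sq lq z hz
  have h3 := (h z hz).1
  rw [e1, e2] at h3
  simp only [Complex.re_ofReal_mul, Complex.im_ofReal_mul, Complex.exp_ofReal_mul_I_re,
    Complex.exp_ofReal_mul_I_im] at h3
  rw [Real.sin_sub]
  have h4 : 0 ≤ (r * r') * (Real.sin (theta q.roots z) * Real.cos (theta p.roots z) -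
      Real.cos (theta q.roots z) * Real.sin (theta p.roots z)) := by linarith
  exact nonneg_of_mul_nonneg_right h4 (by positivity)

/-- For every positive integer `n` and every `T ⊆ [n]`, the polynomial
`A^{T-1}_n(x)` is real-rooted and it interlaces `A^T_{n+1}(x)`, where
`T - 1 = {a - 1 : a ∈ T}`. -/
theorem stmt2 (n : ℕ) (hn : 0 < n) (T : Finset ℕ) (hT : T ⊆ Finset.Icc 1 n) :
    RealRooted (Apoly n (T.image (fun a => a - 1))) ∧
    Interlaces (Apoly n (T.image (fun a => a - 1))) (Apoly (n + 1) T) := by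
  obtain ⟨m, rfl⟩ : ∃ m, n = m + 1 := ⟨n - 1, by omega⟩
  have hg := Good_ppoly (m + 1) T
  have hA := Apoly_eq_ppoly m T
  have hB := Apoly_eq (m + 1) T
  have r1 : RealRooted (Apoly (m + 1) (T.image (fun a => a - 1))) := by
    rw [hA]
    exact realRooted_of_upper _ fun z hz h0 => (hg z hz).2 0 h0
  have r2 : RealRooted (Apoly (m + 1 + 1) T) := by
    rw [hB]
    refine realRooted_of_upper _ fun z hz h0 => ?_
    rw [map_sum] at h0
    have := VV_sum_eq_zero hz _ (hg z hz).1 _ h0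
    exact Finset.sum_eq_zero fun i hi => (hg z hz).2 i (this i hi)
  refine ⟨r1, interlaces_main _ _ r1 r2 (Apoly_coeff_nonneg _ _) (Apoly_coeff_nonneg _ _) ?_⟩
  intro z hz
  rw [hA, hB, map_sum]
  exact VV_sum_right _ _ fun i _ => (hg z hz).1 0 i (Fin.zero_le i)
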